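/- arXiv:1808.06013 — 2 statements merged into one kernel-verified Lean document; each statement's English description precedes it below -/
import Mathlib

section
/- Let φ be an outer local flat folding on a compact convex region K ⊆ ℝ², let u and v be boundary points of K joined by a crease of φ along segment uv, and let C be one of the two regions into which segment uv divides K, such that along the boundary curve of C from u to v the distance from u is monotonically increasing and the distance from v is monotonically decreasing. If φ is the identity on segment uv (which may be arranged by composing φ with a congruence of the plane), then φ(C) is contained in the union of C and the reflection of C across the line through u and v. -/
noncomputable section

open Set

/-- The closed half-plane bounded by the line through `p` with direction `d`,
lying on the counterclockwise side of that line. -/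
def closedHalfPlane (p d : ℂ) : Set ℂ := {z : ℂ | 0 ≤ ((z - p) * starRingEnd ℂ d).im}

/-- The closed wedge with apex `p` spanned by the directions with angles in `[α, β]`. -/
def wedge (p : ℂ) (α β : ℝ) : Set ℂ :=
  {z : ℂ | ∃ r : ℝ, 0 ≤ r ∧ ∃ t : ℝ, α ≤ t ∧ t ≤ β ∧ z = p + r * Complex.exp (t * Complex.I)}

/-- Euclidean three-dimensional space. -/
abbrev Space3 := EuclideanSpace ℝ (Fin 3)

/-- Vertical projection from three-dimensional space to the plane. -/
def proj2 (q : Space3) : ℂ := ⟨q 0, q 1⟩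


/-- `p` is an *unfolded point* of the folding `φ` of the sheet `K`: `φ` agrees with a Euclidean
isometry on the intersection of `K` with some neighborhood of `p`. -/
def UnfoldedPtOn (K : Set ℂ) (φ : ℂ → ℂ) (p : ℂ) : Prop :=
  ∃ U ∈ nhds p, ∃ f : ℂ ≃ᵢ ℂ, Set.EqOn φ ⇑f (U ∩ K)

/-- `p` is a *crease point* of the folding `φ` of the sheet `K`: near `p`, the sheet is covered
by the two closed half-planes bounded by a line through `p`, with `φ` agreeing with two
distinct isometries on the two halves. -/
def CreasePtOn (K : Set ℂ) (φ : ℂ → ℂ) (p : ℂ) : Prop :=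
  ∃ U ∈ nhds p, ∃ d : ℂ, d ≠ 0 ∧ ∃ f₁ f₂ : ℂ ≃ᵢ ℂ, f₁ ≠ f₂ ∧
    Set.EqOn φ ⇑f₁ (U ∩ K ∩ closedHalfPlane p d) ∧
    Set.EqOn φ ⇑f₂ (U ∩ K ∩ closedHalfPlane p (-d))

/-- `p` is a *vertex point* of the folding `φ` of the sheet `K`: near `p`, the sheet is covered
by finitely many (at least three) closed wedges with apex `p`, with `φ` agreeing with an
isometry on each wedge and at least three distinct isometries occurring. -/
def VertexPtOn (K : Set ℂ) (φ : ℂ → ℂ) (p : ℂ) : Prop :=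
  ∃ U ∈ nhds p, ∃ n : ℕ, 3 ≤ n ∧ ∃ (α β : Fin n → ℝ) (f : Fin n → ℂ ≃ᵢ ℂ),
    (∀ i, α i < β i) ∧ (U ∩ K) ⊆ ⋃ i, wedge p (α i) (β i) ∧
    (∀ i, Set.EqOn φ ⇑(f i) (U ∩ K ∩ wedge p (α i) (β i))) ∧
    3 ≤ (Set.range f).ncard

/-- An *outer local flat folding* of a compact convex region `K`: every point of `K` is an
unfolded point, a crease point, or a vertex point, and all vertex points lie on the boundary
of `K`. -/
structure IsOuterLocalFlatFolding (K : Set ℂ) (φ : ℂ → ℂ) : Prop where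
  compact : IsCompact K
  convex : Convex ℝ K
  interior_nonempty : (interior K).Nonempty
  continuousOn : ContinuousOn φ K
  classify : ∀ p ∈ K, UnfoldedPtOn K φ p ∨ CreasePtOn K φ p ∨ VertexPtOn K φ p
  vertex_boundary : ∀ p ∈ K, VertexPtOn K φ p → p ∈ frontier K

/-- The creases of an outer folding are chords of `K`: `u` and `v` are boundary points, the
open segment between them passes through the interior of `K`, and consists of crease points. -/
def IsCreaseOf (K : Set ℂ) (φ : ℂ → ℂ) (u v : ℂ) : Prop :=
  u ∈ frontier K ∧ v ∈ frontier K ∧ u ≠ v ∧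
  openSegment ℝ u v ⊆ interior K ∧
  ∀ z ∈ openSegment ℝ u v, CreasePtOn K φ z

/-- An *outer global flat folding*: an outer local flat folding that, for every `ε > 0`, is
`ε`-close to the vertical projection of a topological embedding of `K` into space. -/
def IsOuterGlobalFlatFolding (K : Set ℂ) (φ : ℂ → ℂ) : Prop :=
  IsOuterLocalFlatFolding K φ ∧
  ∀ ε : ℝ, 0 < ε → ∃ ψ : ℂ → Space3,
    Topology.IsEmbedding (fun p : K => ψ ↑p) ∧ ∀ p ∈ K, dist (φ p) (proj2 (ψ p)) ≤ ε

/-- `C` is one of the two regions into which the segment `uv` divides `K`. -/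
def SideRegion (K : Set ℂ) (u v : ℂ) (C : Set ℂ) : Prop :=
  C = K ∩ {z : ℂ | 0 ≤ ((z - u) * starRingEnd ℂ (v - u)).im} ∨
  C = K ∩ {z : ℂ | ((z - u) * starRingEnd ℂ (v - u)).im ≤ 0}

/-- Along the boundary curve of `C` from `u` to `v` (the part of the boundary of `K` on `C`'s
side), distances from `u` are monotonically increasing and distances from `v` are
monotonically decreasing. -/
def MonotoneBoundaryArc (K : Set ℂ) (u v : ℂ) (C : Set ℂ) : Prop :=
  ∃ γ : ℝ → ℂ, ContinuousOn γ (Set.Icc 0 1) ∧ γ 0 = u ∧ γ 1 = v ∧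
    γ '' Set.Icc 0 1 = frontier K ∩ C ∧
    MonotoneOn (fun t => dist u (γ t)) (Set.Icc 0 1) ∧
    AntitoneOn (fun t => dist v (γ t)) (Set.Icc 0 1)

/-- Reflection of the plane across the line through `u` and `v`. -/
def lineReflect (u v z : ℂ) : ℂ := u + (v - u) * starRingEnd ℂ ((z - u) / (v - u))

/-- A crease `uv` of `φ`, splitting off the region `C` of `K` with monotone boundary arc, is
*safe* when the reflection across the line `uv` of the boundary arc of `C` does not cross any
crease of `φ`. -/
def SafeCrease (K : Set ℂ) (φ : ℂ → ℂ) (u v : ℂ) (C : Set ℂ) : Prop :=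
  IsCreaseOf K φ u v ∧ SideRegion K u v C ∧ MonotoneBoundaryArc K u v C ∧
  ∀ p ∈ lineReflect u v '' (frontier K ∩ C), p ∉ segment ℝ u v → ¬ CreasePtOn K φ p

/-- The vertices of the graph of an outer folding: boundary points of `K` lying on creases. -/
def OuterVertex (K : Set ℂ) (φ : ℂ → ℂ) : Type := {p : ℂ // ∃ q : ℂ, IsCreaseOf K φ p q}

/-- The graph of an outer folding: vertices are boundary points of `K` on creases, and edges
join the two endpoints of each crease. -/
def outerGraph (K : Set ℂ) (φ : ℂ → ℂ) : SimpleGraph (OuterVertex K φ) :=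
  SimpleGraph.fromRel fun a b => IsCreaseOf K φ a.1 b.1

/-- `K` is a (closed, solid) square in the plane. -/
def IsSquareRegion (K : Set ℂ) : Prop :=
  ∃ c w : ℂ, w ≠ 0 ∧
    K = (fun z : ℂ => c + w * z) '' {z : ℂ | z.re ∈ Set.Icc 0 1 ∧ z.im ∈ Set.Icc 0 1}

/-- A folding preserves distances from a given point of the sheet to all nearby points. -/
lemma IsOuterLocalFlatFolding.eventually_dist_eq {K : Set ℂ} {φ : ℂ → ℂ}
    (hφ : IsOuterLocalFlatFolding K φ) {p : ℂ} (hp : p ∈ K) :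
    ∃ U ∈ nhds p, ∀ z ∈ U ∩ K, dist (φ z) (φ p) = dist z p := by
  rcases hφ.classify p hp with ⟨U, hU, f, hf⟩ | ⟨U, hU, d, -, f, g, -, hf, hg⟩ |
    ⟨U, hU, n, -, α, β, f, hαβ, hcov, hf, -⟩
  · refine ⟨U, hU, fun z hz => ?_⟩
    rw [hf hz, hf ⟨mem_of_mem_nhds hU, hp⟩, f.dist_eq]
  · refine ⟨U, hU, fun z hz => ?_⟩
    have hpU : p ∈ U ∩ K := ⟨mem_of_mem_nhds hU, hp⟩
    rcases le_total 0 ((z - p) * starRingEnd ℂ d).im with h | h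
    · rw [hf ⟨hz, h⟩, hf ⟨hpU, by simp [closedHalfPlane]⟩, f.dist_eq]
    · have h' : z ∈ closedHalfPlane p (-d) := by
        simp only [closedHalfPlane, mem_ofPred_eq, map_neg, mul_neg, Complex.neg_im]
        linarith
      rw [hg ⟨hz, h'⟩, hg ⟨hpU, by simp [closedHalfPlane]⟩, g.dist_eq]
  · refine ⟨U, hU, fun z hz => ?_⟩
    obtain ⟨i, hi⟩ := mem_iUnion.1 (hcov hz)
    have hpi : p ∈ wedge p (α i) (β i) := ⟨0, le_rfl, α i, le_rfl, (hαβ i).le, by simp⟩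
    rw [hf i ⟨hz, hi⟩, hf i ⟨⟨mem_of_mem_nhds hU, hp⟩, hpi⟩, (f i).dist_eq]

/-- A folding does not increase distances. -/
lemma IsOuterLocalFlatFolding.dist_le {K : Set ℂ} {φ : ℂ → ℂ}
    (hφ : IsOuterLocalFlatFolding K φ) {x y : ℂ} (hx : x ∈ K) (hy : y ∈ K) :
    dist (φ y) (φ x) ≤ dist y x := by
  let c : ℝ → ℂ := AffineMap.lineMap x y
  have hcont : Continuous c := AffineMap.lineMap_continuous
  have hcK : ∀ t ∈ Icc (0 : ℝ) 1, c t ∈ K := fun t ht =>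
    hφ.convex.segment_subset hx hy (segment_eq_image_lineMap ℝ x y ▸ mem_image_of_mem _ ht)
  have hcd : ∀ s t : ℝ, dist (c s) (c t) = dist s t * dist y x := fun s t => by
    rw [dist_lineMap_lineMap, dist_comm x y]
  have hφc : ContinuousOn (fun t => φ (c t)) (Icc 0 1) :=
    hφ.continuousOn.comp hcont.continuousOn hcK
  let S : Set ℝ := {t | dist (φ (c t)) (φ x) ≤ t * dist y x}
  have hclosed : IsClosed (S ∩ Icc 0 1) := by
    rw [inter_comm]
    exact isClosed_Icc.isClosed_le (f := fun t => dist (φ (c t)) (φ x))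
      (continuous_dist.comp_continuousOn (hφc.prodMk continuousOn_const)) (by fun_prop)
  have hsub : Icc (0 : ℝ) 1 ⊆ S := by
    refine hclosed.Icc_subset_of_forall_mem_nhdsWithin (by simp [S, c]) ?_
    rintro t ⟨htS, ht⟩
    obtain ⟨U, hU, hUd⟩ := hφ.eventually_dist_eq (hcK t ⟨ht.1, ht.2.le⟩)
    filter_upwards [nhdsWithin_le_nhds (hcont.continuousAt.preimage_mem_nhds hU),
      Ioo_mem_nhdsGT ht.2] with s hsU hs
    have h := hUd (c s) ⟨hsU, hcK s ⟨ht.1.trans hs.1.le, hs.2.le⟩⟩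
    rw [hcd, Real.dist_eq, abs_of_pos (sub_pos.2 hs.1)] at h
    have h1 : dist (φ (c t)) (φ x) ≤ t * dist y x := htS
    have h2 := dist_triangle (φ (c s)) (φ (c t)) (φ x)
    change dist (φ (c s)) (φ x) ≤ s * dist y x
    linarith
  simpa [S, c] using hsub (right_mem_Icc.2 zero_le_one)

lemma norm_lt_norm_add_of_re_mul_conj_nonneg {a b : ℂ} (hb : b ≠ 0)
    (h : 0 ≤ (a * starRingEnd ℂ b).re) : ‖a‖ < ‖a + b‖ := by
  refine lt_of_pow_lt_pow_left₀ 2 (norm_nonneg _) ?_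
  rw [Complex.sq_norm, Complex.sq_norm, Complex.normSq_add]
  have := Complex.normSq_pos.2 hb
  linarith

/-- Moving perpendicularly away from the line `uv` increases the distances to `u` and `v`. -/
lemma dist_lt_dist_add_perp {u v z : ℂ} (huv : u ≠ v) {σ s : ℝ} (hσ : σ ^ 2 = 1) (hs : 0 < s)
    (hz : 0 ≤ σ * ((z - u) * starRingEnd ℂ (v - u)).im) :
    dist u z < dist u (z + (s * σ : ℝ) * Complex.I * (v - u)) ∧
      dist v z < dist v (z + (s * σ : ℝ) * Complex.I * (v - u)) := by
  have hσ0 : σ ≠ 0 := by rintro rfl; norm_num at hσ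
  have hne : ((s * σ : ℝ) : ℂ) * Complex.I * (v - u) ≠ 0 :=
    mul_ne_zero (mul_ne_zero (by exact_mod_cast mul_ne_zero hs.ne' hσ0) Complex.I_ne_zero)
      (sub_ne_zero.2 huv.symm)
  have hz' := mul_nonneg hs.le hz
  simp only [dist_comm u, dist_comm v, dist_eq_norm, add_sub_right_comm]
  constructor <;> refine norm_lt_norm_add_of_re_mul_conj_nonneg hne (hz'.trans_eq ?_) <;>
    · simp
      ring

lemma dist_le_dist_add_perp {u v z : ℂ} (huv : u ≠ v) {σ s : ℝ} (hσ : σ ^ 2 = 1) (hs : 0 ≤ s)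
    (hz : 0 ≤ σ * ((z - u) * starRingEnd ℂ (v - u)).im) :
    dist u z ≤ dist u (z + (s * σ : ℝ) * Complex.I * (v - u)) ∧
      dist v z ≤ dist v (z + (s * σ : ℝ) * Complex.I * (v - u)) := by
  rcases hs.eq_or_lt with rfl | hs
  · simp
  · exact (dist_lt_dist_add_perp huv hσ hs hz).imp le_of_lt le_of_lt

lemma im_add_perp_mul_conj (u v z : ℂ) (s σ : ℝ) (hσ : σ ^ 2 = 1) :
    σ * ((z + (s * σ : ℝ) * Complex.I * (v - u) - u) * starRingEnd ℂ (v - u)).im =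
      σ * ((z - u) * starRingEnd ℂ (v - u)).im + s * Complex.normSq (v - u) := by
  simp [Complex.normSq_apply]
  linear_combination s * ((v.re - u.re) ^ 2 + (v.im - u.im) ^ 2) * hσ

/-- A ray perpendicular to a line, starting inside a closed set and leaving it, meets the
frontier of that set. -/
lemma exists_add_mul_mem_frontier {K : Set ℂ} {x n : ℂ} {T : ℝ} (hT : 0 ≤ T) (hx : x ∈ K)
    (hy : x + T * n ∉ K) : ∃ s ∈ Icc 0 T, x + (s : ℂ) * n ∈ frontier K := by
  have hcont : Continuous fun s : ℝ => x + (s : ℂ) * n := by fun_prop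
  by_contra! hf
  have hcover : (fun s : ℝ => x + (s : ℂ) * n) '' Icc 0 T ⊆ interior K ∪ interior Kᶜ := by
    rintro - ⟨s, hs, rfl⟩
    exact compl_frontier_eq_union_interior (s := K) ▸ hf s hs
  have hx' := hcover ⟨0, left_mem_Icc.2 hT, rfl⟩
  have hy' := hcover ⟨T, right_mem_Icc.2 hT, rfl⟩
  obtain ⟨z, -, hz, hz'⟩ :=
    (isPreconnected_Icc.image _ (hcont.continuousOn (s := Icc 0 T))) _ _ isOpen_interior
      isOpen_interior hcover
      ⟨_, ⟨0, left_mem_Icc.2 hT, rfl⟩, hx'.resolve_right fun h =>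
        interior_subset h (by simpa using hx)⟩
      ⟨_, ⟨T, right_mem_Icc.2 hT, rfl⟩, hy'.resolve_left fun h => hy (interior_subset h)⟩
  exact interior_subset hz' (interior_subset hz)

lemma exists_add_mul_notMem {K : Set ℂ} (hK : IsCompact K) (x : ℂ) {n : ℂ} (hn : n ≠ 0) :
    ∃ T : ℝ, 0 ≤ T ∧ x + T * n ∉ K := by
  obtain ⟨R, hR⟩ := hK.isBounded.subset_closedBall x
  have hn' := norm_pos_iff.2 hn
  refine ⟨(|R| + 1) / ‖n‖, by positivity, fun h => ?_⟩
  have h1 := hR h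
  rw [Metric.mem_closedBall, dist_eq_norm, add_sub_cancel_left, norm_mul, Complex.norm_real,
    Real.norm_of_nonneg (by positivity), div_mul_cancel₀ _ hn'.ne'] at h1
  linarith [le_abs_self R]

/-- If a point on the arc side of `uv` is at most as far from both `u` and `v` as some point
of the region cut off by `uv`, then it lies in that region. -/
lemma mem_of_dist_le_of_monotoneBoundaryArc {K C : Set ℂ} {u v p w : ℂ} {σ : ℝ}
    (hK : IsCompact K) (huv : u ≠ v) (hσ : σ ^ 2 = 1) (hseg : segment ℝ u v ⊆ K)
    (hC : C = K ∩ {z : ℂ | 0 ≤ σ * ((z - u) * starRingEnd ℂ (v - u)).im})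
    (hmono : MonotoneBoundaryArc K u v C) (hp : p ∈ C)
    (hw : 0 ≤ σ * ((w - u) * starRingEnd ℂ (v - u)).im)
    (hwu : dist u w ≤ dist u p) (hwv : dist v w ≤ dist v p) : w ∈ C := by
  obtain ⟨γ, -, hγ0, hγ1, hγ, hmu, hmv⟩ := hmono
  have he : v - u ≠ 0 := sub_ne_zero.2 huv.symm
  have hσ0 : σ ≠ 0 := by rintro rfl; norm_num at hσ
  have hN : 0 < Complex.normSq (v - u) := Complex.normSq_pos.2 he
  have hpC := hp
  rw [hC] at hpC
  obtain ⟨hpK, hp0⟩ := hpC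
  have assoc : ∀ s : ℝ, (s : ℂ) * ((σ : ℂ) * Complex.I * (v - u)) =
      (s * σ : ℝ) * Complex.I * (v - u) := fun s => by push_cast; ring
  have arc : ∀ z, 0 ≤ σ * ((z - u) * starRingEnd ℂ (v - u)).im → ∀ s : ℝ, 0 ≤ s →
      z + (s : ℂ) * ((σ : ℂ) * Complex.I * (v - u)) ∈ frontier K →
      ∃ t ∈ Icc (0 : ℝ) 1, γ t = z + (s * σ : ℝ) * Complex.I * (v - u) := by
    intro z hz s hs hf
    rw [assoc] at hf
    have : z + (s * σ : ℝ) * Complex.I * (v - u) ∈ frontier K ∩ C := by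
      refine ⟨hf, hC ▸ ⟨hK.isClosed.frontier_subset hf, ?_⟩⟩
      rw [mem_ofPred_eq, im_add_perp_mul_conj u v z s σ hσ]
      positivity
    rwa [← hγ] at this
  have hn : (σ : ℂ) * Complex.I * (v - u) ≠ 0 :=
    mul_ne_zero (mul_ne_zero (by exact_mod_cast hσ0) Complex.I_ne_zero) he
  obtain ⟨T, hT, hTK⟩ := exists_add_mul_notMem hK p hn
  obtain ⟨s, hs, hsf⟩ := exists_add_mul_mem_frontier hT hpK hTK
  obtain ⟨t, ht, hqt⟩ := arc p hp0 s hs.1 hsf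
  obtain ⟨hpu, hpv⟩ := dist_le_dist_add_perp huv hσ hs.1 hp0
  rw [← hqt] at hpu hpv
  have hu1 : dist u (γ t) ≤ dist u v := hγ1 ▸ hmu ht (right_mem_Icc.2 zero_le_one) ht.2
  have hv1 : dist v (γ t) ≤ dist v u := hγ0 ▸ hmv (left_mem_Icc.2 zero_le_one) ht ht.1
  obtain ⟨ζ, hζ⟩ : ∃ ζ : ℂ, w = u + ζ * (v - u) := ⟨(w - u) / (v - u), by field_simp; ring⟩
  have hζ1 : ‖ζ‖ ≤ 1 := by
    have h := (hwu.trans hpu).trans hu1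
    rw [dist_comm u, dist_comm u, dist_eq_norm, dist_eq_norm, hζ, add_sub_cancel_left,
      norm_mul] at h
    exact le_of_mul_le_mul_right (by simpa using h) (norm_pos_iff.2 he)
  have hζ2 : ‖1 - ζ‖ ≤ 1 := by
    have h := (hwv.trans hpv).trans hv1
    rw [dist_eq_norm, dist_eq_norm, hζ,
      show v - (u + ζ * (v - u)) = (1 - ζ) * (v - u) by ring, norm_mul] at h
    exact le_of_mul_le_mul_right (by simpa using h) (norm_pos_iff.2 he)
  have hre1 : ζ.re ≤ 1 := (Complex.re_le_norm ζ).trans hζ1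
  have hre0 : 0 ≤ ζ.re := by
    have := (Complex.re_le_norm (1 - ζ)).trans hζ2
    simp only [Complex.sub_re, Complex.one_re] at this
    linarith
  set f : ℂ := u + (ζ.re : ℂ) * (v - u) with hf
  have hfK : f ∈ K := hseg <| by
    rw [segment_eq_image']
    exact ⟨ζ.re, ⟨hre0, hre1⟩, by simp [f]⟩
  have hf0 : σ * ((f - u) * starRingEnd ℂ (v - u)).im = 0 := by
    rw [hf, add_sub_cancel_left, mul_assoc, Complex.mul_conj, ← Complex.ofReal_mul,
      Complex.ofReal_im, mul_zero]
  have hwf : w = f + ((σ * ζ.im : ℝ) * σ : ℝ) * Complex.I * (v - u) := by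
    have : (σ * ζ.im) * σ = ζ.im := by linear_combination ζ.im * hσ
    rw [this, hζ, hf]
    nth_rewrite 1 [← Complex.re_add_im ζ]
    ring
  have him : 0 ≤ σ * ζ.im := by
    rw [hwf, im_add_perp_mul_conj _ _ _ _ _ hσ, hf0, zero_add] at hw
    exact nonneg_of_mul_nonneg_left hw hN
  rw [hC]
  refine ⟨by_contra fun hwK => ?_, hw⟩
  have hwK' : f + ((σ * ζ.im : ℝ) : ℂ) * ((σ : ℂ) * Complex.I * (v - u)) ∉ K := by
    rwa [assoc, ← hwf]
  obtain ⟨s', hs', hsf'⟩ := exists_add_mul_mem_frontier him hfK hwK'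
  have hlt : s' < σ * ζ.im := hs'.2.lt_of_ne fun h =>
    hwK' (h ▸ hK.isClosed.frontier_subset hsf')
  obtain ⟨t', ht', hrt⟩ := arc f hf0.ge s' hs'.1 hsf'
  have hr0 : 0 ≤ σ * ((γ t' - u) * starRingEnd ℂ (v - u)).im := by
    rw [hrt, im_add_perp_mul_conj _ _ _ _ _ hσ, hf0, zero_add]
    exact mul_nonneg hs'.1 hN.le
  have hwr : w = γ t' + ((σ * ζ.im - s') * σ : ℝ) * Complex.I * (v - u) := by
    rw [hwf, hrt]
    push_cast
    ring
  obtain ⟨hru, hrv⟩ := dist_lt_dist_add_perp huv hσ (sub_pos.2 hlt) hr0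
  rw [← hwr] at hru hrv
  rcases le_total t' t with h | h
  · exact absurd (hmv ht' ht h) (not_le.2 (hrv.trans_le (hwv.trans hpv)))
  · exact absurd (hmu ht ht' h) (not_le.2 (hru.trans_le (hwu.trans hpu)))

lemma lineReflect_sub_left {u v : ℂ} (z : ℂ) :
    lineReflect u v z - u = (v - u) * starRingEnd ℂ ((z - u) / (v - u)) := by
  simp [lineReflect]

lemma lineReflect_lineReflect {u v : ℂ} (huv : u ≠ v) (z : ℂ) :
    lineReflect u v (lineReflect u v z) = z := by
  have he : v - u ≠ 0 := sub_ne_zero.2 huv.symm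
  rw [lineReflect, lineReflect_sub_left, mul_div_cancel_left₀ _ he, Complex.conj_conj,
    mul_div_cancel₀ _ he, add_sub_cancel]

lemma dist_left_lineReflect {u v : ℂ} (huv : u ≠ v) (z : ℂ) :
    dist u (lineReflect u v z) = dist u z := by
  have he : ‖v - u‖ ≠ 0 := norm_ne_zero_iff.2 (sub_ne_zero.2 huv.symm)
  rw [dist_comm, dist_comm u, dist_eq_norm, dist_eq_norm, lineReflect_sub_left, norm_mul,
    Complex.norm_conj, norm_div, mul_div_cancel₀ _ he]

lemma dist_right_lineReflect {u v : ℂ} (huv : u ≠ v) (z : ℂ) :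
    dist v (lineReflect u v z) = dist v z := by
  have he : v - u ≠ 0 := sub_ne_zero.2 huv.symm
  have h : lineReflect u v z - v = (v - u) * starRingEnd ℂ ((z - v) / (v - u)) := by
    rw [show (z - v) / (v - u) = (z - u) / (v - u) - 1 by field_simp; ring, map_sub, map_one,
      mul_sub, ← lineReflect_sub_left]
    ring
  rw [dist_comm, dist_comm v, dist_eq_norm, dist_eq_norm, h, norm_mul, Complex.norm_conj,
    norm_div, mul_div_cancel₀ _ (norm_ne_zero_iff.2 he)]

lemma im_lineReflect_mul_conj {u v : ℂ} (huv : u ≠ v) (z : ℂ) :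
    ((lineReflect u v z - u) * starRingEnd ℂ (v - u)).im =
      -((z - u) * starRingEnd ℂ (v - u)).im := by
  have he : v - u ≠ 0 := sub_ne_zero.2 huv.symm
  have he' : starRingEnd ℂ (v - u) ≠ 0 := (map_ne_zero _).2 he
  rw [← Complex.conj_im, lineReflect_sub_left, map_div₀, map_mul, Complex.conj_conj]
  congr 1
  field_simp

lemma SideRegion.exists_sign {K C : Set ℂ} {u v : ℂ} (h : SideRegion K u v C) :
    ∃ σ : ℝ, σ ^ 2 = 1 ∧
      C = K ∩ {z : ℂ | 0 ≤ σ * ((z - u) * starRingEnd ℂ (v - u)).im} := by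
  rcases h with h | h
  · exact ⟨1, by norm_num, by simpa only [one_mul] using h⟩
  · exact ⟨-1, by norm_num, by simpa only [neg_mul, one_mul, Left.nonneg_neg_iff] using h⟩

theorem stmt11_lune (K : Set ℂ) (φ : ℂ → ℂ) (hφ : IsOuterLocalFlatFolding K φ)
    (u v : ℂ) (huv : IsCreaseOf K φ u v) (C : Set ℂ)
    (hC : SideRegion K u v C) (hmono : MonotoneBoundaryArc K u v C)
    (hid : Set.EqOn φ id (segment ℝ u v)) :
    φ '' C ⊆ C ∪ lineReflect u v '' C := by
  obtain ⟨hu, hv, hne, -, -⟩ := huv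
  obtain ⟨σ, hσ, hCσ⟩ := hC.exists_sign
  have huK := hφ.compact.isClosed.frontier_subset hu
  have hvK := hφ.compact.isClosed.frontier_subset hv
  have hφu : φ u = u := hid (left_mem_segment ℝ u v)
  have hφv : φ v = v := hid (right_mem_segment ℝ u v)
  rintro - ⟨p, hp, rfl⟩
  have hpK : p ∈ K := by
    rw [hCσ] at hp
    exact hp.1
  have hdu : dist u (φ p) ≤ dist u p := by simpa only [hφu] using hφ.dist_le hpK huK
  have hdv : dist v (φ p) ≤ dist v p := by simpa only [hφv] using hφ.dist_le hpK hvK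
  have key := fun w => mem_of_dist_le_of_monotoneBoundaryArc (w := w) hφ.compact hne hσ
    (hφ.convex.segment_subset huK hvK) hCσ hmono hp
  rcases le_total 0 (σ * ((φ p - u) * starRingEnd ℂ (v - u)).im) with h | h
  · exact Or.inl (key _ h hdu hdv)
  · refine Or.inr ⟨lineReflect u v (φ p), key _ ?_ ?_ ?_, lineReflect_lineReflect hne _⟩
    · rw [im_lineReflect_mul_conj hne]
      linarith
    · rwa [dist_left_lineReflect hne]
    · rwa [dist_right_lineReflect hne]
end
end

section
/- Let K be a closed circular disk, let φ be an outer local flat folding of K, and let R be a region of K bounded by three or more creases of φ. Then at least one of the creases bounding R is a safe crease of φ. -/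
noncomputable section

open Set

/-! ### Planar cross and dot products -/

/-- The cross product of two plane vectors. -/
def cross (z w : ℂ) : ℝ := z.re * w.im - z.im * w.re

/-- The dot product of two plane vectors. -/
def dot (z w : ℂ) : ℝ := z.re * w.re + z.im * w.im

/-- The signed area form of the line through `u` and `v`: positive to the left of `u → v`. -/
def lineSide (u v z : ℂ) : ℝ := ((z - u) * starRingEnd ℂ (v - u)).im

lemma im_mul_conj (z d : ℂ) : (z * starRingEnd ℂ d).im = cross d z := by
  simp [cross]; ring

lemma lineSide_eq_cross (u v z : ℂ) : lineSide u v z = cross (v - u) (z - u) :=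
  im_mul_conj _ _

lemma lineSide_eq (u v z : ℂ) :
    lineSide u v z = (v.re - u.re) * (z.im - u.im) - (v.im - u.im) * (z.re - u.re) := by
  simp [lineSide_eq_cross, cross]

lemma lineSide_swap (u v z : ℂ) : lineSide v u z = -lineSide u v z := by
  simp only [lineSide_eq]; ring

lemma lineSide_eq_cross_sub (u v z : ℂ) : lineSide u v z = cross (u - z) (v - z) := by
  simp [lineSide_eq, cross]; ring

lemma continuous_cross_sub (d p : ℂ) : Continuous fun z => cross d (z - p) := by
  unfold cross; fun_prop

lemma continuous_lineSide (u v : ℂ) : Continuous (lineSide u v) := by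
  unfold lineSide; fun_prop

lemma normSq_pos_re_im {z : ℂ} (h : z ≠ 0) : 0 < z.re ^ 2 + z.im ^ 2 := by
  have := Complex.normSq_pos.2 h
  rw [Complex.normSq_apply] at this
  linarith

/-- If `u, v` lie in this order in the sector from `x` to `r`, the angle from `u` to `v` is at
most the angle from `x` to `r`. -/
lemma dot_mul_cross_le_of_sector {x u v r : ℂ} (hxu : 0 ≤ cross x u) (huv : 0 < cross u v)
    (hvr : 0 ≤ cross v r) (hur : 0 ≤ cross u r) (hxr : 0 < cross x r) :
    dot x r * cross u v ≤ dot u v * cross x r := by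
  have hur' : 0 < cross u r := by
    refine lt_of_le_of_ne hur fun h => ?_
    have : cross x u * cross v r + cross x r * cross u v = cross x v * cross u r := by
      simp only [cross]; ring
    rw [← h, mul_zero] at this
    have := mul_nonneg hxu hvr
    have := mul_pos hxr huv
    linarith
  have key : (dot u v * cross x r - dot x r * cross u v) * cross u r
      = cross v r * cross x r * (u.re ^ 2 + u.im ^ 2)
        + cross x u * cross u v * (r.re ^ 2 + r.im ^ 2) := by
    simp only [cross, dot]; ring
  have : 0 ≤ (dot u v * cross x r - dot x r * cross u v) * cross u r := by
    rw [key]; positivity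
  linarith [nonneg_of_mul_nonneg_left this hur']

/-- Two angles at the origin lying in a half-plane on different sides of a ray `r` add up to at
most a straight angle. -/
lemma sum_angles_of_ray {x r u v s t : ℂ} (hx : x ≠ 0) (hr : r ≠ 0) (hxr : 0 ≤ cross x r)
    (hxu : 0 ≤ cross x u) (hxv : 0 ≤ cross x v) (hxs : 0 ≤ cross x s) (hxt : 0 ≤ cross x t)
    (huv : 0 < cross u v) (hst : 0 < cross s t) (hur : 0 ≤ cross u r) (hvr : 0 ≤ cross v r)
    (hrs : 0 ≤ cross r s) (hrt : 0 ≤ cross r t) :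
    0 ≤ dot u v * cross s t + cross u v * dot s t := by
  have hX := normSq_pos_re_im hx
  have hR := normSq_pos_re_im hr
  have hxr' : 0 < cross x r := by
    refine lt_of_le_of_ne hxr fun h => ?_
    have e (z : ℂ) : (x.re ^ 2 + x.im ^ 2) * cross z r = -(dot x r * cross x z) := by
      have : (x.re ^ 2 + x.im ^ 2) * cross z r
          = -(dot x r * cross x z) + cross x r * dot x z := by simp only [cross, dot]; ring
      rw [this, ← h]; ring
    have e2 : dot x r ^ 2 = (x.re ^ 2 + x.im ^ 2) * (r.re ^ 2 + r.im ^ 2) := by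
      have : dot x r ^ 2 + cross x r ^ 2 = (x.re ^ 2 + x.im ^ 2) * (r.re ^ 2 + r.im ^ 2) := by
        simp only [cross, dot]; ring
      rw [← h] at this; linarith
    have hk : dot x r ≠ 0 := by
      intro hk; rw [hk] at e2; have := mul_pos hX hR; linarith
    have par (z w : ℂ) : (x.re ^ 2 + x.im ^ 2) * cross z w
        = dot x z * cross x w - cross x z * dot x w := by simp only [cross, dot]; ring
    have anti (z : ℂ) : cross r z = -cross z r := by simp only [cross]; ring
    rcases lt_or_gt_of_ne hk with hk | hk
    · have z (y : ℂ) (h1 : 0 ≤ cross x y) (h2 : 0 ≤ cross r y) : cross x y = 0 := by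
        have := e y; rw [anti] at h2; nlinarith
      have := par s t
      rw [z s hxs hrs, z t hxt hrt] at this
      nlinarith
    · have z (y : ℂ) (h1 : 0 ≤ cross x y) (h2 : 0 ≤ cross y r) : cross x y = 0 := by
        have := e y; nlinarith
      have := par u v
      rw [z u hxu hur, z v hxv hvr] at this
      nlinarith
  have h1 := dot_mul_cross_le_of_sector hxu huv hvr hur hxr'
  have n1 (z : ℂ) : cross z (-x) = cross x z := by simp [cross]; ring
  have n2 : dot r (-x) = -dot x r := by simp [dot]; ring
  have h2 := dot_mul_cross_le_of_sector (x := r) (r := -x) hrs hst (by rwa [n1]) (by rwa [n1])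
    (by rwa [n1])
  rw [n1, n2] at h2
  have h3 : 0 ≤ (dot u v * cross s t + cross u v * dot s t) * cross x r := by nlinarith
  exact nonneg_of_mul_nonneg_left h3 hxr'

/-- Two non-crossing segments seen from the origin inside a half-plane: the two viewing angles
add up to at most a straight angle. -/
lemma sum_angles_of_noncrossing {x u v s t : ℂ} (hx : x ≠ 0)
    (hxu : 0 ≤ cross x u) (hxv : 0 ≤ cross x v) (hxs : 0 ≤ cross x s) (hxt : 0 ≤ cross x t)
    (huv : 0 < cross u v) (hst : 0 < cross s t)
    (hs : 0 ≤ lineSide u v s) (ht : 0 ≤ lineSide u v t)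
    (hu : 0 ≤ lineSide s t u) (hv : 0 ≤ lineSide s t v)
    (hne : ¬ (lineSide u v s = 0 ∧ lineSide u v t = 0)) :
    0 ≤ dot u v * cross s t + cross u v * dot s t := by
  -- `g` separates the two sectors
  set g : ℂ := (cross u v : ℂ) * (t - s) - (cross s t : ℂ) * (v - u) with hg
  have gz (z : ℂ) : cross g z = cross u v * cross (t - s) z - cross s t * cross (v - u) z := by
    simp [hg, cross]; ring
  have gs : cross g s = -(cross s t * lineSide u v s) := by
    rw [gz]; simp [lineSide_eq, cross]; ring
  have gt : cross g t = -(cross s t * lineSide u v t) := by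
    rw [gz]; simp [lineSide_eq, cross]; ring
  have gu : cross g u = cross u v * lineSide s t u := by
    rw [gz]; simp [lineSide_eq, cross]; ring
  have gv : cross g v = cross u v * lineSide s t v := by
    rw [gz]; simp [lineSide_eq, cross]; ring
  have g0 : g ≠ 0 := by
    intro h
    rw [h] at gs gt
    apply hne
    constructor
    · have : cross s t * lineSide u v s = 0 := by simp [cross] at gs ⊢; tauto
      exact (mul_eq_zero.1 this).resolve_left hst.ne'
    · have : cross s t * lineSide u v t = 0 := by simp [cross] at gt ⊢; tauto
      exact (mul_eq_zero.1 this).resolve_left hst.ne'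
  have anti (z w : ℂ) : cross w z = -cross z w := by simp only [cross]; ring
  have negr (z w : ℂ) : cross z (-w) = -cross z w := by
    simp only [cross, Complex.neg_re, Complex.neg_im]; ring
  have negl (z w : ℂ) : cross (-z) w = -cross z w := by
    simp only [cross, Complex.neg_re, Complex.neg_im]; ring
  have pgs : cross g s ≤ 0 := by rw [gs]; have := mul_nonneg hst.le hs; linarith
  have pgt : cross g t ≤ 0 := by rw [gt]; have := mul_nonneg hst.le ht; linarith
  have pgu : 0 ≤ cross g u := by rw [gu]; positivity
  have pgv : 0 ≤ cross g v := by rw [gv]; positivity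
  rcases le_total 0 (cross x g) with h | h
  · have := sum_angles_of_ray hx g0 h hxs hxt hxu hxv hst huv (by rw [anti]; linarith)
      (by rw [anti]; linarith) pgu pgv
    linarith
  · exact sum_angles_of_ray hx (neg_ne_zero.2 g0) (by rw [negr]; linarith) hxu hxv hxs hxt huv hst
      (by rw [negr, anti]; linarith) (by rw [negr, anti]; linarith)
      (by rw [negl]; linarith) (by rw [negl]; linarith)

/-! ### Local structure of creases -/

lemma IsometryEquiv.eq_of_eqOn_isOpen {f g : ℂ ≃ᵢ ℂ} {O : Set ℂ} (hO : IsOpen O)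
    (hne : O.Nonempty) (h : EqOn f g O) : f = g := by
  have := AffineMap.ext_on (k := ℝ) (f := f.toRealAffineIsometryEquiv.toAffineEquiv.toAffineMap)
    (g := g.toRealAffineIsometryEquiv.toAffineEquiv.toAffineMap) (hO.affineSpan_eq_top hne)
    (fun z hz => by simpa using h hz)
  ext z
  simpa using congrArg (fun F => F z) this

section Folding

variable {K : Set ℂ} {φ : ℂ → ℂ}

lemma UnfoldedPtOn.eventually {p : ℂ} (h : UnfoldedPtOn K φ p) :
    ∀ᶠ z in nhds p, UnfoldedPtOn K φ z := by
  obtain ⟨U, hU, f, hf⟩ := h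
  filter_upwards [eventually_mem_nhds_iff.2 hU] with z hz using ⟨U, hz, f, hf⟩

lemma mem_closedHalfPlane {p d z : ℂ} : z ∈ closedHalfPlane p d ↔ 0 ≤ cross d (z - p) := by
  rw [closedHalfPlane, mem_ofPred_eq, im_mul_conj]

lemma cross_neg_left (d z : ℂ) : cross (-d) z = -cross d z := by
  simp only [cross, Complex.neg_re, Complex.neg_im]; ring

lemma CreasePtOn.not_unfoldedPtOn {p : ℂ} (hp : p ∈ interior K) (h : CreasePtOn K φ p) :
    ¬ UnfoldedPtOn K φ p := by
  rintro ⟨V, hV, f, hf⟩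
  obtain ⟨U, hU, d, hd, f₁, f₂, hne, h₁, h₂⟩ := h
  have agree (e : ℂ) (he : e ≠ 0) (g : ℂ ≃ᵢ ℂ) (hg : EqOn φ g (U ∩ K ∩ closedHalfPlane p e)) :
      f = g := by
    refine IsometryEquiv.eq_of_eqOn_isOpen
      (O := interior (U ∩ V ∩ K) ∩ {z | 0 < cross e (z - p)})
      (isOpen_interior.inter (isOpen_lt continuous_const (continuous_cross_sub e p))) ?_ ?_
    · have hW : U ∩ V ∩ K ∈ nhds p := Filter.inter_mem (Filter.inter_mem hU hV)
        (mem_interior_iff_mem_nhds.1 hp)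
      have hc : Filter.Tendsto (fun τ : ℝ => p + τ * (Complex.I * e)) (nhdsWithin 0 (Ioi 0))
          (nhds p) := by
        have : Continuous (fun τ : ℝ => p + τ * (Complex.I * e)) := by fun_prop
        have := this.tendsto 0
        simp only [Complex.ofReal_zero, zero_mul, add_zero] at this
        exact this.mono_left nhdsWithin_le_nhds
      obtain ⟨τ, h1, h2⟩ := ((hc.eventually (eventually_mem_nhds_iff.2 hW)).and
        self_mem_nhdsWithin).exists
      refine ⟨_, mem_interior_iff_mem_nhds.2 h1, ?_⟩
      have := normSq_pos_re_im he
      have h3 : cross e (p + τ * (Complex.I * e) - p) = τ * (e.re ^ 2 + e.im ^ 2) := by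
        simp [cross]; ring
      rw [mem_ofPred_eq, h3]
      exact mul_pos h2 this
    · rintro z ⟨hz, hz'⟩
      have hz := interior_subset hz
      rw [← hf ⟨hz.1.2, hz.2⟩, hg ⟨⟨hz.1.1, hz.2⟩, mem_closedHalfPlane.2 (le_of_lt hz')⟩]
  exact hne ((agree d hd f₁ h₁).symm.trans (agree (-d) (neg_ne_zero.2 hd) f₂ h₂))

/-- Near a crease point, the points on the fold line are crease points and the points off the
fold line are unfolded. -/
lemma CreasePtOn.eventually {p : ℂ} (h : CreasePtOn K φ p) :
    ∃ d : ℂ, d ≠ 0 ∧ ∀ᶠ z in nhds p, (cross d (z - p) = 0 → CreasePtOn K φ z) ∧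
      (cross d (z - p) ≠ 0 → UnfoldedPtOn K φ z) := by
  obtain ⟨U, hU, d, hd, f₁, f₂, hne, h₁, h₂⟩ := h
  refine ⟨d, hd, ?_⟩
  filter_upwards [eventually_mem_nhds_iff.2 hU] with z hz
  constructor
  · intro h0
    have same (w : ℂ) : cross d (w - z) = cross d (w - p) := by
      have : cross d (w - p) = cross d (w - z) + cross d (z - p) := by
        simp only [cross, Complex.sub_re, Complex.sub_im]; ring
      rw [this, h0, add_zero]
    have e1 : closedHalfPlane z d = closedHalfPlane p d := by
      ext w; simp only [mem_closedHalfPlane, same]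
    have e2 : closedHalfPlane z (-d) = closedHalfPlane p (-d) := by
      ext w; simp only [mem_closedHalfPlane, cross_neg_left, same]
    exact ⟨U, hz, d, hd, f₁, f₂, hne, e1 ▸ h₁, e2 ▸ h₂⟩
  · intro h0
    rcases lt_or_gt_of_ne h0 with h0 | h0
    · refine ⟨U ∩ {w | cross d (w - p) < 0}, Filter.inter_mem hz ?_, f₂, ?_⟩
      · exact (isOpen_lt (continuous_cross_sub d p) continuous_const).mem_nhds h0
      · rintro w ⟨⟨hw, hw'⟩, hk⟩
        refine h₂ ⟨⟨hw, hk⟩, mem_closedHalfPlane.2 ?_⟩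
        rw [cross_neg_left]; have : cross d (w - p) < 0 := hw'
        linarith
    · refine ⟨U ∩ {w | 0 < cross d (w - p)}, Filter.inter_mem hz ?_, f₁, ?_⟩
      · exact (isOpen_lt continuous_const (continuous_cross_sub d p)).mem_nhds h0
      · rintro w ⟨⟨hw, hw'⟩, hk⟩
        exact h₁ ⟨⟨hw, hk⟩, mem_closedHalfPlane.2 (le_of_lt hw')⟩

lemma exists_eq_add_mul_of_cross_eq_zero {d w : ℂ} (hd : d ≠ 0) (h : cross d w = 0) :
    ∃ τ : ℝ, w = τ * d := by
  have := normSq_pos_re_im hd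
  refine ⟨dot d w / (d.re ^ 2 + d.im ^ 2), ?_⟩
  simp only [cross] at h
  apply Complex.ext
  · simp only [dot, Complex.re_ofReal_mul]
    field_simp
    linear_combination (-d.im) * h
  · simp only [dot, Complex.im_ofReal_mul]
    field_simp
    linear_combination (d.re) * h

/-- The crease through an interior crease point extends along its whole line. -/
lemma IsOuterLocalFlatFolding.exists_crease_line (hφ : IsOuterLocalFlatFolding K φ) {p : ℂ}
    (hp : p ∈ interior K) (h : CreasePtOn K φ p) :
    ∃ d : ℂ, d ≠ 0 ∧ ∀ z ∈ interior K, cross d (z - p) = 0 → CreasePtOn K φ z := by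
  obtain ⟨d, hd, hev⟩ := h.eventually
  refine ⟨d, hd, ?_⟩
  have cont : Continuous (fun τ : ℝ => p + τ * d) := by fun_prop
  set S : Set ℝ := (fun τ : ℝ => p + τ * d) ⁻¹' interior K with hS
  have hSpre : IsPreconnected S := by
    refine Convex.isPreconnected ?_
    have : S = (AffineMap.lineMap p (p + d) : ℝ →ᵃ[ℝ] ℂ) ⁻¹' interior K := by
      ext τ; simp [hS, AffineMap.lineMap_apply, add_comm]
    rw [this]
    exact hφ.convex.interior.affine_preimage _
  have hline (τ τ' : ℝ) (e : ℂ) :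
      cross e (p + τ' * d - (p + τ * d)) = (τ' - τ) * cross e d := by
    simp [cross]; ring
  set A : Set ℝ := {τ | ∀ᶠ τ' in nhds τ, CreasePtOn K φ (p + (τ' : ℝ) * d)} with hA
  set B : Set ℝ := {τ | ∀ᶠ τ' in nhdsWithin τ {τ}ᶜ, UnfoldedPtOn K φ (p + (τ' : ℝ) * d)} with hB
  have hAo : IsOpen A := isOpen_setOfPred_eventually_nhds
  have hBo : IsOpen B := isOpen_setOfPred_eventually_nhdsWithin
  have hcov : S ⊆ A ∪ B := by
    intro τ hτ
    have hτ' : p + (τ : ℂ) * d ∈ interior K := hτ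
    rcases hφ.classify _ (interior_subset hτ') with hu | hc | hv
    · right
      exact ((cont.tendsto τ).eventually hu.eventually).filter_mono nhdsWithin_le_nhds
    · obtain ⟨e, he, hev'⟩ := hc.eventually
      have hev' := (cont.tendsto τ).eventually hev'
      by_cases hed : cross e d = 0
      · left
        filter_upwards [hev'] with τ' h'
        apply h'.1
        rw [hline, hed, mul_zero]
      · right
        filter_upwards [hev'.filter_mono nhdsWithin_le_nhds, self_mem_nhdsWithin] with τ' h' hne
        apply h'.2
        rw [hline]
        exact mul_ne_zero (sub_ne_zero.2 hne) hed
    · exact absurd hτ' (by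
        have := hφ.vertex_boundary _ (interior_subset hτ') hv
        rw [frontier] at this
        exact this.2)
  have hdis : S ∩ (A ∩ B) = ∅ := by
    rw [Set.eq_empty_iff_forall_notMem]
    rintro τ ⟨hτ, hτA, hτB⟩
    have hS' : ∀ᶠ τ' in nhds τ, τ' ∈ S := (isOpen_interior.preimage cont).mem_nhds hτ
    obtain ⟨τ', ⟨h1, h2⟩, h3⟩ := (((hτA.filter_mono nhdsWithin_le_nhds).and hτB).and
      (hS'.filter_mono nhdsWithin_le_nhds)).exists
    exact h1.not_unfoldedPtOn h3 h2
  intro z hz hz0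
  obtain ⟨τ, hτ⟩ := exists_eq_add_mul_of_cross_eq_zero hd hz0
  have hzτ : z = p + τ * d := by rw [← hτ]; ring
  have h0A : (0 : ℝ) ∈ A := by
    have h0 := cont.tendsto 0
    simp only [Complex.ofReal_zero, zero_mul, add_zero] at h0
    have := h0.eventually hev
    filter_upwards [this] with τ' h'
    apply h'.1
    have := hline 0 τ' d
    simp only [Complex.ofReal_zero, zero_mul, add_zero] at this
    rw [this]; simp [cross]; right; ring
  have h0S : (0 : ℝ) ∈ S := by simpa [hS] using hp
  have hSA : S ⊆ A := by
    rcases isPreconnected_iff_subset_of_disjoint.1 hSpre A B hAo hBo hcov hdis with h | h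
    · exact h
    · exact absurd (show (0 : ℝ) ∈ S ∩ (A ∩ B) from ⟨h0S, h0A, h h0S⟩) (by simp [hdis])
  have hτS : τ ∈ S := by rw [hS, mem_preimage, ← hzτ]; exact hz
  have := (hSA hτS).self_of_nhds
  rwa [hzτ]

/-- A line through an interior point whose interior points are all crease points contains no
unfolded point of the sheet. -/
lemma not_unfoldedPtOn_of_crease_line (hK : Convex ℝ K) {p d : ℂ} (hp : p ∈ interior K)
    (h : ∀ z ∈ interior K, cross d (z - p) = 0 → CreasePtOn K φ z) {z : ℂ} (hz : z ∈ K)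
    (hz0 : cross d (z - p) = 0) : ¬ UnfoldedPtOn K φ z := by
  intro hu
  have hmem : z ∈ closure (openSegment ℝ p z) := by
    rw [closure_openSegment]; exact right_mem_segment ℝ p z
  obtain ⟨w, hw, hwu⟩ := (mem_closure_iff_frequently.1 hmem).and_eventually hu.eventually |>.exists
  have hwi := hK.openSegment_interior_self_subset_interior hp hz hw
  refine (h w hwi ?_).not_unfoldedPtOn hwi hwu
  obtain ⟨a, b, -, -, hab, rfl⟩ := hw
  have : cross d (a • p + b • z - p) = b * cross d (z - p) := by
    simp [cross]
    obtain rfl : b = 1 - a := by linarith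
    ring
  rw [this, hz0, mul_zero]

/-- A connected set of unfolded points lies strictly on one side of a crease line. -/
lemma IsPreconnected.one_side {R : Set ℂ} (hR : IsPreconnected R)
    (hRu : ∀ z ∈ R, z ∈ K ∧ UnfoldedPtOn K φ z) {p d : ℂ}
    (h : ∀ z ∈ K, cross d (z - p) = 0 → ¬ UnfoldedPtOn K φ z) :
    (∀ z ∈ R, 0 < cross d (z - p)) ∨ (∀ z ∈ R, cross d (z - p) < 0) := by
  rcases isPreconnected_iff_subset_of_disjoint.1 hR {z | 0 < cross d (z - p)}
    {z | cross d (z - p) < 0} (isOpen_lt continuous_const (continuous_cross_sub d p))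
    (isOpen_lt (continuous_cross_sub d p) continuous_const)
    (fun z hz => by
      rcases lt_trichotomy (cross d (z - p)) 0 with h0 | h0 | h0
      · exact Or.inr h0
      · exact absurd (hRu z hz).2 (h z (hRu z hz).1 h0)
      · exact Or.inl h0)
    (by
      rw [Set.eq_empty_iff_forall_notMem]
      rintro z ⟨-, h1, h2⟩
      exact lt_asymm (mem_ofPred.1 h1) (mem_ofPred.1 h2)) with h | h
  · exact Or.inl h
  · exact Or.inr h

/-! ### Chords of a disk -/

section Disk

variable {c : ℂ} {ρ : ℝ}

lemma dist_sq_eq (z w : ℂ) : dist z w ^ 2 = (z.re - w.re) ^ 2 + (z.im - w.im) ^ 2 := by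
  rw [Complex.dist_eq, Complex.sq_norm, Complex.normSq_apply]
  simp only [Complex.sub_re, Complex.sub_im]; ring

lemma sq_eq_of_mem_sphere {z : ℂ} (hz : z ∈ Metric.sphere c ρ) :
    (z.re - c.re) ^ 2 + (z.im - c.im) ^ 2 = ρ ^ 2 := by
  rw [← dist_sq_eq, Metric.mem_sphere.1 hz]

lemma mem_ball_iff_sq (hρ : 0 < ρ) {z : ℂ} :
    z ∈ Metric.ball c ρ ↔ (z.re - c.re) ^ 2 + (z.im - c.im) ^ 2 < ρ ^ 2 := by
  rw [← dist_sq_eq, Metric.mem_ball]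
  exact (sq_lt_sq₀ dist_nonneg hρ.le).symm

lemma normSq_sub_pos {u v : ℂ} (h : u ≠ v) : 0 < (v.re - u.re) ^ 2 + (v.im - u.im) ^ 2 := by
  simpa using normSq_pos_re_im (sub_ne_zero.2 h.symm)

lemma exists_of_lineSide_eq_zero {u v z : ℂ} (h : u ≠ v) (hz : lineSide u v z = 0) :
    ∃ τ : ℝ, z = u + τ * (v - u) := by
  rw [lineSide_eq_cross] at hz
  obtain ⟨τ, hτ⟩ := exists_eq_add_mul_of_cross_eq_zero (sub_ne_zero.2 h.symm) hz
  exact ⟨τ, by rw [← hτ]; ring⟩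

/-- The power of a point of a chord line with respect to the circle. -/
lemma power_of_chord_point {u v : ℂ} (hu : u ∈ Metric.sphere c ρ) (hv : v ∈ Metric.sphere c ρ)
    (τ : ℝ) :
    ((u + τ * (v - u)).re - c.re) ^ 2 + ((u + τ * (v - u)).im - c.im) ^ 2
      = ρ ^ 2 - τ * (1 - τ) * ((v.re - u.re) ^ 2 + (v.im - u.im) ^ 2) := by
  have h1 := sq_eq_of_mem_sphere hu
  have h2 := sq_eq_of_mem_sphere hv
  simp only [Complex.add_re, Complex.add_im, Complex.re_ofReal_mul, Complex.im_ofReal_mul,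
    Complex.sub_re, Complex.sub_im]
  linear_combination (1 - τ) * h1 + τ * h2

lemma exists_convex_of_mem_ball (hρ : 0 < ρ) {u v z : ℂ} (huv : u ≠ v)
    (hu : u ∈ Metric.sphere c ρ) (hv : v ∈ Metric.sphere c ρ) (hz : z ∈ Metric.ball c ρ)
    (h0 : lineSide u v z = 0) : ∃ τ : ℝ, 0 < τ ∧ τ < 1 ∧ z = u + τ * (v - u) := by
  obtain ⟨τ, rfl⟩ := exists_of_lineSide_eq_zero huv h0
  rw [mem_ball_iff_sq hρ, power_of_chord_point hu hv] at hz
  have hD := normSq_sub_pos huv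
  have : 0 < τ * (1 - τ) := by
    by_contra hn
    have := mul_nonpos_of_nonpos_of_nonneg (not_lt.1 hn) hD.le
    nlinarith
  refine ⟨τ, ?_, ?_, rfl⟩ <;> nlinarith

lemma eq_or_eq_of_mem_sphere {u v z : ℂ} (huv : u ≠ v)
    (hu : u ∈ Metric.sphere c ρ) (hv : v ∈ Metric.sphere c ρ) (hz : z ∈ Metric.sphere c ρ)
    (h0 : lineSide u v z = 0) : z = u ∨ z = v := by
  obtain ⟨τ, rfl⟩ := exists_of_lineSide_eq_zero huv h0
  have hz := sq_eq_of_mem_sphere hz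
  rw [power_of_chord_point hu hv] at hz
  have hD := normSq_sub_pos huv
  have : τ * (1 - τ) = 0 := by
    have : τ * (1 - τ) * ((v.re - u.re) ^ 2 + (v.im - u.im) ^ 2) = 0 := by linarith
    exact (mul_eq_zero.1 this).resolve_right hD.ne'
  rcases mul_eq_zero.1 this with h | h
  · left; simp [h]
  · right; obtain rfl : τ = 1 := by linarith
    simp

lemma segment_eq_of_collinear {u v s t : ℂ} (huv : u ≠ v) (hst : s ≠ t)
    (hu : u ∈ Metric.sphere c ρ) (hv : v ∈ Metric.sphere c ρ) (hs : s ∈ Metric.sphere c ρ)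
    (ht : t ∈ Metric.sphere c ρ) (h1 : lineSide u v s = 0) (h2 : lineSide u v t = 0) :
    segment ℝ u v = segment ℝ s t := by
  rcases eq_or_eq_of_mem_sphere huv hu hv hs h1 with rfl | rfl <;>
    rcases eq_or_eq_of_mem_sphere huv hu hv ht h2 with rfl | rfl
  · exact absurd rfl hst
  · rfl
  · exact segment_symm ..
  · exact absurd rfl hst

/-- If the chords `uv`, `st` do not cross and bound a region containing `q`, then no interior
point of the disk lies beyond both of them. -/
lemma not_beyond_both (hρ : 0 < ρ) {u v s t q z : ℂ} (huv : u ≠ v) (hst : s ≠ t)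
    (hu : u ∈ Metric.sphere c ρ) (hv : v ∈ Metric.sphere c ρ) (hs : s ∈ Metric.sphere c ρ)
    (ht : t ∈ Metric.sphere c ρ) (hq : q ∈ Metric.closedBall c ρ) (hz : z ∈ Metric.ball c ρ)
    (hq1 : 0 < lineSide u v q) (hq2 : 0 < lineSide s t q)
    (hus : 0 ≤ lineSide u v s) (hut : 0 ≤ lineSide u v t)
    (hsu : 0 ≤ lineSide s t u) (hsv : 0 ≤ lineSide s t v)
    (hne : segment ℝ u v ≠ segment ℝ s t)
    (hz1 : lineSide u v z ≤ 0) (hz2 : lineSide s t z ≤ 0) : False := by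
  have comb (a b x y : ℂ) (τ : ℝ) :
      lineSide a b (x + τ * (y - x)) = (1 - τ) * lineSide a b x + τ * lineSide a b y := by
    simp [lineSide_eq]; ring
  have main : ∀ u v s t : ℂ, s ≠ t → s ∈ Metric.sphere c ρ → t ∈ Metric.sphere c ρ →
      0 < lineSide u v q → 0 < lineSide s t q → 0 ≤ lineSide u v s → 0 ≤ lineSide u v t →
      lineSide u v z ≤ 0 → lineSide s t z ≤ 0 →
      lineSide u v q * (-lineSide s t z) ≤ lineSide s t q * (-lineSide u v z) →
      lineSide u v s = 0 ∧ lineSide u v t = 0 := by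
    intro u v s t hst hs ht hq1 hq2 hus hut hz1 hz2 hle
    set B := lineSide s t q with hB
    set B' := lineSide s t z with hB'
    have hpos : 0 < B - B' := by linarith
    set τ := B / (B - B') with hτ
    have hτ0 : 0 < τ := div_pos hq2 hpos
    have hτ1 : τ ≤ 1 := (div_le_one hpos).2 (by linarith)
    have h1τ : 1 - τ = -B' / (B - B') := by rw [hτ]; field_simp; ring
    have hw0 : lineSide s t (q + τ * (z - q)) = 0 := by
      rw [comb, h1τ, hτ, ← hB, ← hB']; field_simp; ring
    have hwb : q + τ * (z - q) ∈ Metric.ball c ρ := by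
      rcases hτ1.eq_or_lt with h | h
      · rw [h]; simpa using hz
      · rw [← interior_closedBall c hρ.ne'] at hz ⊢
        refine (convex_closedBall c ρ).openSegment_self_interior_subset_interior hq hz
          ⟨1 - τ, τ, by linarith, hτ0, by ring, ?_⟩
        simp only [Complex.real_smul, Complex.ofReal_sub, Complex.ofReal_one]; ring
    have hwA : lineSide u v (q + τ * (z - q)) ≤ 0 := by
      rw [comb, h1τ, hτ]
      have : -B' / (B - B') * lineSide u v q + B / (B - B') * lineSide u v z
          = -(B * (-lineSide u v z) - lineSide u v q * (-B')) / (B - B') := by ring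
      rw [this]
      exact div_nonpos_of_nonpos_of_nonneg (by linarith) hpos.le
    obtain ⟨σ, h0, h1, hσ⟩ := exists_convex_of_mem_ball hρ hst hs ht hwb hw0
    rw [hσ, comb] at hwA
    have e1 := mul_nonneg (sub_nonneg.2 h1.le) hus
    have e2 := mul_nonneg h0.le hut
    constructor
    · exact (mul_eq_zero.1 (le_antisymm (by linarith) e1)).resolve_left (by linarith)
    · exact (mul_eq_zero.1 (le_antisymm (by linarith) e2)).resolve_left h0.ne'
  rcases le_total (lineSide u v q * (-lineSide s t z)) (lineSide s t q * (-lineSide u v z))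
    with h | h
  · obtain ⟨h1, h2⟩ := main u v s t hst hs ht hq1 hq2 hus hut hz1 hz2 h
    exact hne (segment_eq_of_collinear huv hst hu hv hs ht h1 h2)
  · obtain ⟨h1, h2⟩ := main s t u v huv hu hv hq2 hq1 hsu hsv hz2 hz1 h
    exact hne (segment_eq_of_collinear hst huv hs ht hu hv h1 h2).symm

/-- The half-plane through `p` cannot contain both a chord `uv` whose reflected arc passes
through `p` and a non-crossing chord `st` subtending at least as large an arc. -/
lemma false_of_reflected_arc (hρ : 0 < ρ) {u v s t p x : ℂ} (huv : u ≠ v) (hst : s ≠ t)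
    (hu : u ∈ Metric.sphere c ρ) (hv : v ∈ Metric.sphere c ρ) (hs : s ∈ Metric.sphere c ρ)
    (ht : t ∈ Metric.sphere c ρ) (hp : p ∈ Metric.ball c ρ) (hx : x ≠ 0)
    (hus : 0 ≤ lineSide u v s) (hut : 0 ≤ lineSide u v t)
    (hsu : 0 ≤ lineSide s t u) (hsv : 0 ≤ lineSide s t v)
    (hne : segment ℝ u v ≠ segment ℝ s t)
    (hp1 : 0 < lineSide u v p) (hp2 : 0 < lineSide s t p)
    (hxu : 0 ≤ cross x (u - p)) (hxv : 0 ≤ cross x (v - p))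
    (hxs : 0 ≤ cross x (s - p)) (hxt : 0 ≤ cross x (t - p))
    (harc : ((v.re - u.re) ^ 2 + (v.im - u.im) ^ 2) *
      ((p.re - c.re) ^ 2 + (p.im - c.im) ^ 2 - ρ ^ 2) = -4 * lineSide u v p * lineSide u v c)
    (hle : lineSide s t c / ((t.re - s.re) ^ 2 + (t.im - s.im) ^ 2) ≤
      lineSide u v c / ((v.re - u.re) ^ 2 + (v.im - u.im) ^ 2)) : False := by
  have trans (a b z : ℂ) : lineSide (a - p) (b - p) (z - p) = lineSide a b z := by
    simp only [lineSide_eq, Complex.sub_re, Complex.sub_im]; ring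
  have key := sum_angles_of_noncrossing (u := u - p) (v := v - p) (s := s - p) (t := t - p) hx
    hxu hxv hxs hxt (by rwa [← lineSide_eq_cross_sub]) (by rwa [← lineSide_eq_cross_sub])
    (by rwa [trans]) (by rwa [trans]) (by rwa [trans]) (by rwa [trans])
    (by
      rw [trans, trans]
      rintro ⟨h1, h2⟩
      exact hne (segment_eq_of_collinear huv hst hu hv hs ht h1 h2))
  rw [← lineSide_eq_cross_sub, ← lineSide_eq_cross_sub] at key
  have hdot (a b : ℂ) (ha : a ∈ Metric.sphere c ρ) (hb : b ∈ Metric.sphere c ρ) :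
      ((b.re - a.re) ^ 2 + (b.im - a.im) ^ 2) * dot (a - p) (b - p)
      = ((b.re - a.re) ^ 2 + (b.im - a.im) ^ 2) *
          ((p.re - c.re) ^ 2 + (p.im - c.im) ^ 2 - ρ ^ 2)
        + 2 * lineSide a b c * lineSide a b p := by
    have h1 := sq_eq_of_mem_sphere ha
    have h2 := sq_eq_of_mem_sphere hb
    simp only [dot, lineSide_eq, Complex.sub_re, Complex.sub_im]
    linear_combination
      (-((a.re - b.re) * (p.re - c.re) + (a.im - b.im) * (p.im - c.im))
        + ((a.re - c.re) * (b.re - c.re) + (a.im - c.im) * (b.im - c.im))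
        - ((b.re - c.re) ^ 2 + (b.im - c.im) ^ 2)) * h1
      + (((a.re - b.re) * (p.re - c.re) + (a.im - b.im) * (p.im - c.im))
        + ((a.re - c.re) * (b.re - c.re) + (a.im - c.im) * (b.im - c.im))
        - ((a.re - c.re) ^ 2 + (a.im - c.im) ^ 2)) * h2
  have d1 := hdot u v hu hv
  have d2 := hdot s t hs ht
  have hD1 := normSq_sub_pos huv
  have hD2 := normSq_sub_pos hst
  rw [harc] at d1
  rw [mem_ball_iff_sq hρ] at hp
  rw [div_le_div_iff₀ hD2 hD1] at hle
  generalize (v.re - u.re) ^ 2 + (v.im - u.im) ^ 2 = D1 at *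
  generalize (t.re - s.re) ^ 2 + (t.im - s.im) ^ 2 = D2 at *
  have hpow : D2 * ((p.re - c.re) ^ 2 + (p.im - c.im) ^ 2 - ρ ^ 2) < 0 :=
    mul_neg_of_pos_of_neg hD2 (by linarith)
  generalize lineSide u v p = P1 at *
  generalize lineSide s t p = P2 at *
  generalize dot (u - p) (v - p) = T1 at *
  generalize dot (s - p) (t - p) = T2 at *
  generalize lineSide u v c = C1 at *
  generalize lineSide s t c = C2 at *
  have e1 : D2 * T2 < 2 * C2 * P2 := by linarith
  have e2 : 0 ≤ D1 * D2 * (T1 * P2 + P1 * T2) := by positivity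
  have e3 : D1 * D2 * (T1 * P2 + P1 * T2) = D2 * P2 * (D1 * T1) + D1 * P1 * (D2 * T2) := by ring
  have e4 : D1 * P1 * (D2 * T2) < D1 * P1 * (2 * C2 * P2) :=
    mul_lt_mul_of_pos_left e1 (by positivity)
  have e5 : 0 ≤ 2 * P1 * P2 * (C1 * D2 - C2 * D1) :=
    mul_nonneg (by positivity) (by linarith)
  rw [d1] at e3
  nlinarith

/-! ### The boundary arc and its reflection -/

lemma lineSide_circle (c a : ℂ) (b t : ℝ) :
    lineSide (c + a) (c + a * Complex.exp ((2 * b : ℝ) * Complex.I))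
      (c + a * Complex.exp ((2 * t : ℝ) * Complex.I))
      = 4 * (a.re ^ 2 + a.im ^ 2) * (Real.sin b * Real.sin t * Real.sin (t - b)) := by
  simp only [lineSide_eq, Complex.add_re, Complex.add_im, Complex.mul_re, Complex.mul_im,
    Complex.exp_ofReal_mul_I_re, Complex.exp_ofReal_mul_I_im, Real.sin_two_mul, Real.cos_two_mul,
    Real.sin_sub]
  have h1 := Real.sin_sq_add_cos_sq b
  have h2 := Real.sin_sq_add_cos_sq t
  linear_combination (4 * (a.re ^ 2 + a.im ^ 2)) * (Real.sin t * Real.cos t * h1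
    - Real.sin b * Real.cos b * h2)

lemma dist_circle (c a : ℂ) (s t : ℝ) :
    dist (c + a * Complex.exp ((2 * s : ℝ) * Complex.I))
      (c + a * Complex.exp ((2 * t : ℝ) * Complex.I)) = 2 * ‖a‖ * |Real.sin (s - t)| := by
  rw [← sq_eq_sq₀ dist_nonneg (by positivity), dist_sq_eq, mul_pow, mul_pow, sq_abs,
    Complex.sq_norm, Complex.normSq_apply]
  simp only [Complex.add_re, Complex.add_im, Complex.mul_re, Complex.mul_im,
    Complex.exp_ofReal_mul_I_re, Complex.exp_ofReal_mul_I_im, Real.sin_two_mul, Real.cos_two_mul,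
    Real.sin_sub]
  have h1 := Real.sin_sq_add_cos_sq s
  have h2 := Real.sin_sq_add_cos_sq t
  have e1 : Real.sin s ^ 2 = 1 - Real.cos s ^ 2 := by linarith
  have e2 : Real.sin t ^ 2 = 1 - Real.cos t ^ 2 := by linarith
  ring_nf
  simp only [e1, e2]
  ring

lemma exists_angle (hρ : 0 < ρ) {u z : ℂ} (hu : u ∈ Metric.sphere c ρ)
    (hz : z ∈ Metric.sphere c ρ) : ∃ t : ℝ, -(Real.pi / 2) < t ∧ t ≤ Real.pi / 2 ∧
      z = c + (u - c) * Complex.exp ((2 * t : ℝ) * Complex.I) := by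
  rw [mem_sphere_iff_norm] at hu hz
  have hu0 : u - c ≠ 0 := by rw [← norm_pos_iff, hu]; exact hρ
  refine ⟨Complex.arg ((z - c) / (u - c)) / 2, ?_, ?_, ?_⟩
  · linarith [Complex.neg_pi_lt_arg ((z - c) / (u - c))]
  · linarith [Complex.arg_le_pi ((z - c) / (u - c))]
  · have := Complex.norm_mul_exp_arg_mul_I ((z - c) / (u - c))
    rw [norm_div, hu, hz, div_self hρ.ne', Complex.ofReal_one, one_mul] at this
    rw [mul_div_cancel₀ _ (two_ne_zero), this, mul_div_cancel₀ _ hu0]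
    ring

/-- A circular arc shorter than a half-circle is monotone. -/
lemma monotoneBoundaryArc_of_center (hρ : 0 < ρ) {u v : ℂ} (hu : u ∈ Metric.sphere c ρ)
    (hv : v ∈ Metric.sphere c ρ) (hc : 0 < lineSide u v c) :
    MonotoneBoundaryArc (Metric.closedBall c ρ) u v
      (Metric.closedBall c ρ ∩ {z | lineSide u v z ≤ 0}) := by
  obtain ⟨b, hb1, hb2, hvb⟩ := exists_angle hρ hu hv
  set a := u - c with ha
  have hua : u = c + a := by rw [ha]; ring
  have ha0 : a ≠ 0 := by
    rw [← norm_pos_iff, mem_sphere_iff_norm.1 hu]; exact hρ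
  have hA := normSq_pos_re_im ha0
  have hb : 0 < b ∧ b < Real.pi / 2 := by
    have : lineSide u v c = (a.re ^ 2 + a.im ^ 2) * Real.sin (2 * b) := by
      rw [hua, hvb]
      simp only [lineSide_eq, Complex.add_re, Complex.add_im, Complex.mul_re, Complex.mul_im,
        Complex.exp_ofReal_mul_I_re, Complex.exp_ofReal_mul_I_im]
      ring
    rw [this] at hc
    have hs := pos_of_mul_pos_right hc hA.le
    constructor
    · by_contra h
      exact absurd hs (not_lt.2 (Real.sin_nonpos_of_nonpos_of_neg_pi_le (by linarith) (by linarith)))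
    · refine lt_of_le_of_ne hb2 fun h => ?_
      rw [h, mul_div_cancel₀ _ (two_ne_zero), Real.sin_pi] at hs
      exact lt_irrefl _ hs
  obtain ⟨hb0, hb2⟩ := hb
  have hsb : 0 < Real.sin b := Real.sin_pos_of_pos_of_lt_pi hb0 (by linarith [Real.pi_pos])
  have hside (t : ℝ) : lineSide u v (c + a * Complex.exp ((2 * t : ℝ) * Complex.I))
      = 4 * (a.re ^ 2 + a.im ^ 2) * (Real.sin b * Real.sin t * Real.sin (t - b)) := by
    rw [hvb, ← lineSide_circle, ← hua]
  have hna : ‖a‖ = ρ := mem_sphere_iff_norm.1 hu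
  have hsph (t : ℝ) : c + a * Complex.exp ((2 * t : ℝ) * Complex.I) ∈ Metric.sphere c ρ := by
    rw [mem_sphere_iff_norm, add_sub_cancel_left, norm_mul, Complex.norm_exp_ofReal_mul_I, hna,
      mul_one]
  have hu0 : u = c + a * Complex.exp ((2 * (0 : ℝ) : ℝ) * Complex.I) := by simp [hua]
  refine ⟨fun τ => c + a * Complex.exp ((2 * (b * τ) : ℝ) * Complex.I), ?_, ?_, ?_, ?_, ?_, ?_⟩
  · exact Continuous.continuousOn (by fun_prop)
  · simp [hua]
  · simp only [mul_one]; exact hvb.symm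
  · rw [frontier_closedBall c hρ.ne']
    ext z
    constructor
    · rintro ⟨τ, ⟨h0, h1⟩, rfl⟩
      have hle : b * τ ≤ b := by nlinarith
      have h0' : 0 ≤ b * τ := by positivity
      refine ⟨hsph _, Metric.sphere_subset_closedBall (hsph _), ?_⟩
      change lineSide u v _ ≤ 0
      rw [hside]
      refine mul_nonpos_of_nonneg_of_nonpos (by positivity)
        (mul_nonpos_of_nonneg_of_nonpos (mul_nonneg hsb.le ?_) ?_)
      · exact Real.sin_nonneg_of_nonneg_of_le_pi h0' (by linarith [Real.pi_pos])
      · exact Real.sin_nonpos_of_nonpos_of_neg_pi_le (by linarith) (by linarith)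
    · rintro ⟨hz, -, hz0⟩
      have hz0 : lineSide u v z ≤ 0 := hz0
      obtain ⟨t, ht1, ht2, rfl⟩ := exists_angle hρ hu hz
      rw [← ha, hside] at hz0
      have hz1 : Real.sin b * Real.sin t * Real.sin (t - b) ≤ 0 := by
        by_contra h
        exact absurd hz0 (not_le.2 (mul_pos (by positivity) (not_le.1 h)))
      have ht0 : 0 ≤ t := by
        by_contra h
        have e1 := Real.sin_neg_of_neg_of_neg_pi_lt (not_le.1 h) (by linarith)
        have e2 := Real.sin_neg_of_neg_of_neg_pi_lt (x := t - b) (by linarith) (by linarith)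
        have := mul_pos_of_neg_of_neg e1 e2
        have := mul_pos hsb this
        linarith
      have htb : t ≤ b := by
        by_contra h
        have e1 := Real.sin_pos_of_pos_of_lt_pi (x := t) (by linarith) (by linarith)
        have e2 := Real.sin_pos_of_pos_of_lt_pi (x := t - b) (by linarith) (by linarith)
        have := mul_pos (mul_pos hsb e1) e2
        linarith
      refine ⟨t / b, ⟨by positivity, (div_le_one hb0).2 htb⟩, ?_⟩
      simp only [mul_div_cancel₀ _ hb0.ne']
      rfl
  · rintro τ ⟨h0, h1⟩ τ' ⟨h0', h1'⟩ hle
    have e1 : b * τ ≤ b * τ' := by nlinarith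
    have e2 : b * τ' ≤ b := by nlinarith
    have e3 : 0 ≤ b * τ := by positivity
    simp only
    rw [hu0, dist_circle, dist_circle, zero_sub, zero_sub, Real.sin_neg, Real.sin_neg, abs_neg,
      abs_neg, abs_of_nonneg (Real.sin_nonneg_of_nonneg_of_le_pi e3 (by linarith)),
      abs_of_nonneg (Real.sin_nonneg_of_nonneg_of_le_pi (e3.trans e1) (by linarith))]
    gcongr
    exact Real.sin_le_sin_of_le_of_le_pi_div_two (by linarith) (by linarith) e1
  · rintro τ ⟨h0, h1⟩ τ' ⟨h0', h1'⟩ hle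
    have e1 : b * τ ≤ b * τ' := by nlinarith
    have e2 : b * τ' ≤ b := by nlinarith
    have e3 : 0 ≤ b * τ := by positivity
    simp only
    rw [hvb, dist_circle, dist_circle,
      abs_of_nonneg (Real.sin_nonneg_of_nonneg_of_le_pi (x := b - b * τ) (by linarith)
        (by linarith)),
      abs_of_nonneg (Real.sin_nonneg_of_nonneg_of_le_pi (x := b - b * τ') (by linarith)
        (by linarith))]
    gcongr
    exact Real.sin_le_sin_of_le_of_le_pi_div_two (by linarith) (by linarith) (by linarith)

lemma lineReflect_eq {u v : ℂ} (huv : u ≠ v) (z : ℂ) :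
    ∃ q : ℂ, z = u + (v - u) * q ∧ lineReflect u v z = u + (v - u) * starRingEnd ℂ q :=
  ⟨(z - u) / (v - u), by rw [mul_div_cancel₀ _ (sub_ne_zero.2 huv.symm)]; ring, rfl⟩

lemma lineSide_lineReflect {u v : ℂ} (huv : u ≠ v) (z : ℂ) :
    lineSide u v (lineReflect u v z) = -lineSide u v z := by
  obtain ⟨q, h1, h2⟩ := lineReflect_eq huv z
  rw [h2, h1]
  simp [lineSide_eq]; ring

lemma lineReflect_of_lineSide_eq_zero {u v z : ℂ} (huv : u ≠ v) (h : lineSide u v z = 0) :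
    lineReflect u v z = z := by
  obtain ⟨τ, rfl⟩ := exists_of_lineSide_eq_zero huv h
  rw [lineReflect, add_sub_cancel_left, mul_div_cancel_right₀ _ (sub_ne_zero.2 huv.symm),
    Complex.conj_ofReal]
  ring

lemma power_lineReflect {u v z : ℂ} (huv : u ≠ v) (hz : z ∈ Metric.sphere c ρ) :
    ((v.re - u.re) ^ 2 + (v.im - u.im) ^ 2) *
      (((lineReflect u v z).re - c.re) ^ 2 + ((lineReflect u v z).im - c.im) ^ 2 - ρ ^ 2)
      = -4 * lineSide u v (lineReflect u v z) * lineSide u v c := by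
  have hz := sq_eq_of_mem_sphere hz
  obtain ⟨q, h1, h2⟩ := lineReflect_eq huv z
  rw [h2]
  rw [h1] at hz
  simp [lineSide_eq] at hz ⊢
  linear_combination ((v.re - u.re) ^ 2 + (v.im - u.im) ^ 2) * hz

lemma lineReflect_swap {u v : ℂ} (huv : u ≠ v) (z : ℂ) :
    lineReflect v u z = lineReflect u v z := by
  have h1 : v - u ≠ 0 := sub_ne_zero.2 huv.symm
  have h2 : u - v ≠ 0 := sub_ne_zero.2 huv
  have h3 : (z - v) / (u - v) = 1 - (z - u) / (v - u) := by field_simp; ring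
  rw [lineReflect, lineReflect, h3, map_sub, map_one]
  ring

end Disk

/-! ### Safe creases -/

lemma IsCreaseOf.symm {u v : ℂ} (h : IsCreaseOf K φ u v) : IsCreaseOf K φ v u := by
  obtain ⟨h1, h2, h3, h4, h5⟩ := h
  rw [openSegment_symm] at h4 h5
  exact ⟨h2, h1, h3.symm, h4, h5⟩

lemma MonotoneBoundaryArc.symm {u v : ℂ} {C : Set ℂ} (h : MonotoneBoundaryArc K u v C) :
    MonotoneBoundaryArc K v u C := by
  obtain ⟨γ, h1, h2, h3, h4, h5, h6⟩ := h
  have hm : MapsTo (fun t : ℝ => 1 - t) (Icc 0 1) (Icc 0 1) := fun t ht =>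
    ⟨by linarith [ht.2], by linarith [ht.1]⟩
  refine ⟨fun t => γ (1 - t), h1.comp (by fun_prop) hm, by simpa, by simpa, ?_,
    fun s hs t ht hst => h6 (hm ht) (hm hs) (by linarith),
    fun s hs t ht hst => h5 (hm ht) (hm hs) (by linarith)⟩
  rw [← h4]
  ext z
  constructor
  · rintro ⟨t, ht, rfl⟩
    exact ⟨1 - t, hm ht, rfl⟩
  · rintro ⟨t, ht, rfl⟩
    exact ⟨1 - t, hm ht, by simp⟩

lemma SafeCrease.symm {u v : ℂ} {C : Set ℂ} (h : SafeCrease K φ u v C) :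
    SafeCrease K φ v u C := by
  obtain ⟨h1, h2, h3, h4⟩ := h
  refine ⟨h1.symm, ?_, h3.symm, ?_⟩
  · have e (z : ℂ) : ((z - v) * starRingEnd ℂ (u - v)).im
        = -((z - u) * starRingEnd ℂ (v - u)).im := lineSide_swap u v z
    simp only [SideRegion, e] at h2 ⊢
    simp only [Left.nonneg_neg_iff, Left.neg_nonpos_iff]
    exact h2.symm
  · have : lineReflect v u = lineReflect u v := funext (lineReflect_swap h1.2.2.1)
    rwa [this, segment_symm]

/-- The oriented chord `uv` is a crease on the boundary of `R`, with `R` on its left. -/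
structure IsLeftBounding (K : Set ℂ) (φ : ℂ → ℂ) (R : Set ℂ) (u v : ℂ) : Prop where
  isCreaseOf : IsCreaseOf K φ u v
  subset_frontier : openSegment ℝ u v ⊆ frontier R
  lineSide_pos : ∀ z ∈ R, 0 < lineSide u v z

namespace IsLeftBounding

variable {R : Set ℂ} {u v s t : ℂ}

lemma segment_subset_closure (h : IsLeftBounding K φ R u v) : segment ℝ u v ⊆ closure R := by
  rw [← closure_openSegment]
  exact closure_minimal (h.subset_frontier.trans frontier_subset_closure) isClosed_closure

lemma left_mem_closure (h : IsLeftBounding K φ R u v) : u ∈ closure R :=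
  h.segment_subset_closure (left_mem_segment ℝ u v)

lemma right_mem_closure (h : IsLeftBounding K φ R u v) : v ∈ closure R :=
  h.segment_subset_closure (right_mem_segment ℝ u v)

lemma lineSide_nonneg (h : IsLeftBounding K φ R u v) {z : ℂ} (hz : z ∈ closure R) :
    0 ≤ lineSide u v z :=
  closure_minimal (fun w hw => (h.lineSide_pos w hw).le)
    (isClosed_le continuous_const (continuous_lineSide u v)) hz

end IsLeftBounding

lemma IsCreaseOf.not_unfoldedPtOn (hK : Convex ℝ K) {c : ℂ} {ρ : ℝ} (hρ : 0 < ρ)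
    (hKb : K = Metric.closedBall c ρ) {u v z : ℂ} (h : IsCreaseOf K φ u v) (hz : z ∈ K)
    (h0 : lineSide u v z = 0) : ¬ UnfoldedPtOn K φ z := by
  obtain ⟨hu, hv, huv, hint, hcr⟩ := h
  rw [hKb, frontier_closedBall c hρ.ne'] at hu hv
  set m := midpoint ℝ u v with hm
  have hmo : m ∈ openSegment ℝ u v := by
    refine ⟨1 / 2, 1 / 2, by norm_num, by norm_num, by norm_num, ?_⟩
    rw [hm, midpoint_eq_smul_add, smul_add]; norm_num
  have hside (w : ℂ) : cross (v - u) (w - m) = lineSide u v w := by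
    have : m = (1 / 2 : ℝ) • u + (1 / 2 : ℝ) • v := by
      rw [hm, midpoint_eq_smul_add, smul_add]; norm_num
    rw [this, lineSide_eq]
    simp [cross]; ring
  refine not_unfoldedPtOn_of_crease_line (d := v - u) hK (hint hmo) (fun w hw hw0 => ?_) hz
    (by rw [hside, h0])
  rw [hside] at hw0
  rw [hKb, interior_closedBall c hρ.ne'] at hw
  obtain ⟨τ, h0, h1, rfl⟩ := exists_convex_of_mem_ball hρ huv hu hv hw hw0
  refine hcr _ ⟨1 - τ, τ, by linarith, h0, by ring, ?_⟩
  simp only [Complex.real_smul, Complex.ofReal_sub, Complex.ofReal_one]; ring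

/-- The cotangent-type measure of the arc cut off by the oriented chord `uv` of a circle with
center `c`: it decreases as the arc to the right of `u → v` grows. -/
def capCot (c u v : ℂ) : ℝ := lineSide u v c / ((v.re - u.re) ^ 2 + (v.im - u.im) ^ 2)

/-- Among three oriented chords bounding a region, the one cutting off the smallest arc is
safe. -/
lemma IsLeftBounding.exists_safeCrease {c : ℂ} {ρ : ℝ} (hρ : 0 < ρ)
    (hK : K = Metric.closedBall c ρ) (hφ : IsOuterLocalFlatFolding K φ) {R : Set ℂ} {q : ℂ}
    (hq : q ∈ R) (hRpre : IsPreconnected R) (hRu : ∀ z ∈ R, z ∈ K ∧ UnfoldedPtOn K φ z)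
    {u v s t s' t' : ℂ} (h₁ : IsLeftBounding K φ R u v) (h₂ : IsLeftBounding K φ R s t)
    (h₃ : IsLeftBounding K φ R s' t') (h12 : segment ℝ u v ≠ segment ℝ s t)
    (h13 : segment ℝ u v ≠ segment ℝ s' t') (h23 : segment ℝ s t ≠ segment ℝ s' t')
    (hle₂ : capCot c s t ≤ capCot c u v) (hle₃ : capCot c s' t' ≤ capCot c u v) :
    ∃ C, SafeCrease K φ u v C := by
  have sph {a b : ℂ} (h : IsLeftBounding K φ R a b) :
      a ≠ b ∧ a ∈ Metric.sphere c ρ ∧ b ∈ Metric.sphere c ρ := by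
    obtain ⟨ha, hb, hab, -⟩ := h.isCreaseOf
    rw [hK, frontier_closedBall c hρ.ne'] at ha hb
    exact ⟨hab, ha, hb⟩
  have beyond {a b a' b' z : ℂ} (h : IsLeftBounding K φ R a b) (h' : IsLeftBounding K φ R a' b')
      (hne : segment ℝ a b ≠ segment ℝ a' b') (hz : z ∈ Metric.ball c ρ)
      (hz1 : lineSide a b z ≤ 0) (hz2 : lineSide a' b' z ≤ 0) : False := by
    obtain ⟨hab, ha, hb⟩ := sph h
    obtain ⟨hab', ha', hb'⟩ := sph h'
    exact not_beyond_both hρ hab hab' ha hb ha' hb' (hK ▸ (hRu q hq).1) hz (h.lineSide_pos q hq)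
      (h'.lineSide_pos q hq) (h.lineSide_nonneg h'.left_mem_closure)
      (h.lineSide_nonneg h'.right_mem_closure) (h'.lineSide_nonneg h.left_mem_closure)
      (h'.lineSide_nonneg h.right_mem_closure) hne hz1 hz2
  obtain ⟨huv, hu, hv⟩ := sph h₁
  have hcenter : 0 < lineSide u v c := by
    by_contra hc
    have hc := not_lt.1 hc
    have hD1 := normSq_sub_pos huv
    have hD2 := normSq_sub_pos (sph h₂).1
    have h0 : capCot c s t ≤ 0 := hle₂.trans (div_nonpos_of_nonpos_of_nonneg hc hD1.le)
    rw [capCot, div_le_iff₀ hD2, zero_mul] at h0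
    exact beyond h₁ h₂ h12 (Metric.mem_ball_self hρ) hc h0
  refine ⟨K ∩ {z | lineSide u v z ≤ 0}, h₁.isCreaseOf, Or.inr rfl, ?_, ?_⟩
  · rw [hK]
    exact monotoneBoundaryArc_of_center hρ hu hv hcenter
  rintro p ⟨w, ⟨hw, -, hw0⟩, rfl⟩ hps hcp
  rw [hK, frontier_closedBall c hρ.ne'] at hw
  have hw0 : lineSide u v w ≤ 0 := hw0
  have hwneg : lineSide u v w < 0 := by
    refine lt_of_le_of_ne hw0 fun h0 => hps ?_
    rw [lineReflect_of_lineSide_eq_zero huv h0]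
    rcases eq_or_eq_of_mem_sphere huv hu hv hw h0 with rfl | rfl
    · exact left_mem_segment ..
    · exact right_mem_segment ..
  have harc := power_lineReflect huv hw
  have hp1 : 0 < lineSide u v (lineReflect u v w) := by
    rw [lineSide_lineReflect huv]; linarith
  generalize lineReflect u v w = p at *
  have hpb : p ∈ Metric.ball c ρ := by
    rw [mem_ball_iff_sq hρ]
    have hD := normSq_sub_pos huv
    have := mul_pos hp1 hcenter
    by_contra hn
    have := mul_nonneg hD.le (sub_nonneg.2 (not_lt.1 hn))
    linarith
  have hpi : p ∈ interior K := by rwa [hK, interior_closedBall c hρ.ne']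
  obtain ⟨d, hd, hline⟩ := hφ.exists_crease_line hpi hcp
  obtain ⟨x, hx, hxR⟩ : ∃ x : ℂ, x ≠ 0 ∧ ∀ z ∈ R, 0 < cross x (z - p) := by
    rcases hRpre.one_side hRu
      (fun z hz hz0 => not_unfoldedPtOn_of_crease_line hφ.convex hpi hline hz hz0) with h | h
    · exact ⟨d, hd, h⟩
    · refine ⟨-d, neg_ne_zero.2 hd, fun z hz => ?_⟩
      rw [cross_neg_left]
      linarith [h z hz]
  have hxcl (z : ℂ) (hz : z ∈ closure R) : 0 ≤ cross x (z - p) :=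
    closure_minimal (fun w hw => (hxR w hw).le)
      (isClosed_le continuous_const (continuous_cross_sub x p)) hz
  have final {a b : ℂ} (h : IsLeftBounding K φ R a b) (hne : segment ℝ u v ≠ segment ℝ a b)
      (hle : capCot c a b ≤ capCot c u v) (hp2 : 0 < lineSide a b p) : False := by
    obtain ⟨hab, ha, hb⟩ := sph h
    exact false_of_reflected_arc hρ huv hab hu hv ha hb hpb hx
      (h₁.lineSide_nonneg h.left_mem_closure) (h₁.lineSide_nonneg h.right_mem_closure)
      (h.lineSide_nonneg h₁.left_mem_closure) (h.lineSide_nonneg h₁.right_mem_closure) hne hp1 hp2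
      (hxcl _ h₁.left_mem_closure) (hxcl _ h₁.right_mem_closure) (hxcl _ h.left_mem_closure)
      (hxcl _ h.right_mem_closure) harc hle
  rcases lt_or_ge 0 (lineSide s t p) with h | h
  · exact final h₂ h12 hle₂ h
  · rcases lt_or_ge 0 (lineSide s' t' p) with h' | h'
    · exact final h₃ h13 hle₃ h'
    · exact beyond h₂ h₃ h23 hpb h h'

/-- A crease on the boundary of `R` can be oriented so that `R` lies on its left. -/
lemma exists_isLeftBounding {c : ℂ} {ρ : ℝ} (hρ : 0 < ρ) (hK : K = Metric.closedBall c ρ)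
    {R : Set ℂ} (hRpre : IsPreconnected R) (hRu : ∀ z ∈ R, z ∈ K ∧ UnfoldedPtOn K φ z)
    {e : ℂ × ℂ} (he : IsCreaseOf K φ e.1 e.2) (hR : openSegment ℝ e.1 e.2 ⊆ frontier R) :
    ∃ e' : ℂ × ℂ, (e' = e ∨ e' = e.swap) ∧ IsLeftBounding K φ R e'.1 e'.2 := by
  have hconv : Convex ℝ K := hK ▸ convex_closedBall c ρ
  rcases hRpre.one_side hRu (p := e.1) (d := e.2 - e.1) (fun z hz hz0 =>
    he.not_unfoldedPtOn hconv hρ hK hz (by rwa [lineSide_eq_cross])) with h | h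
  · exact ⟨e, Or.inl rfl, he, hR, fun z hz => by rw [lineSide_eq_cross]; exact h z hz⟩
  · refine ⟨e.swap, Or.inr rfl, he.symm, by rwa [Prod.fst_swap, Prod.snd_swap, openSegment_symm],
      fun z hz => ?_⟩
    rw [Prod.fst_swap, Prod.snd_swap, lineSide_swap, lineSide_eq_cross]
    linarith [h z hz]

end Folding

theorem stmt13_disk_safe_crease (K : Set ℂ) (φ : ℂ → ℂ)
    (hdisk : ∃ (c : ℂ) (ρ : ℝ), 0 < ρ ∧ K = Metric.closedBall c ρ)
    (hφ : IsOuterLocalFlatFolding K φ)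
    (R : Set ℂ) (q : ℂ) (hq : q ∈ K ∧ UnfoldedPtOn K φ q)
    (hR : R = connectedComponentIn {p : ℂ | p ∈ K ∧ UnfoldedPtOn K φ p} q)
    (cr : Set (ℂ × ℂ))
    (hcr : ∀ e ∈ cr, IsCreaseOf K φ e.1 e.2 ∧ openSegment ℝ e.1 e.2 ⊆ frontier R)
    (hdistinct : ∀ e ∈ cr, ∀ e' ∈ cr, e ≠ e' → segment ℝ e.1 e.2 ≠ segment ℝ e'.1 e'.2)
    (hthree : 3 ≤ cr.ncard) :
    ∃ e ∈ cr, ∃ C : Set ℂ, SafeCrease K φ e.1 e.2 C := by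
  obtain ⟨c, ρ, hρ, hK⟩ := hdisk
  have hqR : q ∈ R := hR ▸ mem_connectedComponentIn hq
  have hRpre : IsPreconnected R := hR ▸ isPreconnected_connectedComponentIn
  have hRu : ∀ z ∈ R, z ∈ K ∧ UnfoldedPtOn K φ z := by
    rw [hR]
    exact fun z hz => connectedComponentIn_subset {p : ℂ | p ∈ K ∧ UnfoldedPtOn K φ p} q hz
  have hor : ∀ e : ℂ × ℂ, ∃ e' : ℂ × ℂ, e ∈ cr →
      (e' = e ∨ e' = e.swap) ∧ IsLeftBounding K φ R e'.1 e'.2 := by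
    intro e
    by_cases he : e ∈ cr
    · obtain ⟨e', h⟩ := exists_isLeftBounding hρ hK hRpre hRu (hcr e he).1 (hcr e he).2
      exact ⟨e', fun _ => h⟩
    · exact ⟨e, fun h => absurd h he⟩
  choose o ho using hor
  have hseg (e : ℂ × ℂ) (he : e ∈ cr) : segment ℝ (o e).1 (o e).2 = segment ℝ e.1 e.2 := by
    rcases (ho e he).1 with h | h <;> rw [h]
    exact segment_symm ..
  have hfin : cr.Finite := Set.finite_of_ncard_pos (by omega)
  have hne : cr.Nonempty := Set.nonempty_of_ncard_ne_zero (by omega)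
  obtain ⟨e, he, hmax⟩ := hfin.exists_maximalFor (fun e => capCot c (o e).1 (o e).2) cr hne
  have hmax (e' : ℂ × ℂ) (he' : e' ∈ cr) :
      capCot c (o e').1 (o e').2 ≤ capCot c (o e).1 (o e).2 := by
    rcases le_total (capCot c (o e').1 (o e').2) (capCot c (o e).1 (o e).2) with h | h
    · exact h
    · exact hmax he' h
  have hcard : 1 < (cr \ {e}).ncard := by
    rw [Set.ncard_sdiff_singleton_of_mem he]; omega
  obtain ⟨e₂, h₂, e₃, h₃, h23⟩ := (Set.one_lt_ncard (hfin.sdiff)).1 hcard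
  have hsegne (f g : ℂ × ℂ) (hf : f ∈ cr) (hg : g ∈ cr) (h : f ≠ g) :
      segment ℝ (o f).1 (o f).2 ≠ segment ℝ (o g).1 (o g).2 := by
    rw [hseg f hf, hseg g hg]; exact hdistinct f hf g hg h
  obtain ⟨C, hC⟩ := (ho e he).2.exists_safeCrease hρ hK hφ hqR hRpre hRu (ho e₂ h₂.1).2
    (ho e₃ h₃.1).2 (hsegne e e₂ he h₂.1 (Ne.symm h₂.2)) (hsegne e e₃ he h₃.1 (Ne.symm h₃.2))
    (hsegne e₂ e₃ h₂.1 h₃.1 h23) (hmax e₂ h₂.1) (hmax e₃ h₃.1)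
  refine ⟨e, he, C, ?_⟩
  rcases (ho e he).1 with h | h
  · rwa [h] at hC
  · rw [h] at hC
    exact hC.symm
end
end
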